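/- Let S ∈ ℝ_+^{m×n} be a slack matrix, i.e., conv(col(S)) = aff(col(S)) ∩ ℝ_+^m, and suppose row i of S is 0/1-valued. Let S' ∈ ℝ_+^{(m+1)×n} be the matrix obtained from S by appending the row 1 − S_i (the entrywise complement of row i). Then S' is a slack matrix: conv(col(S')) = aff(col(S')) ∩ ℝ_+^{m+1}. -/

import Mathlib

/-- The set of columns of a matrix. -/
def colSet {ι κ : Type*} (S : Matrix ι κ ℝ) : Set (ι → ℝ) :=
  Set.range (fun j => fun i => S i j)

/-- A nonnegative matrix `S` is a slack matrix (Gouveia et al. characterization) if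
`conv(col(S)) = aff(col(S)) ∩ ℝ₊^m`. -/
def IsSlackMatrix {ι κ : Type*} (S : Matrix ι κ ℝ) : Prop :=
  (∀ i j, 0 ≤ S i j) ∧
    convexHull ℝ (colSet S)
      = (affineSpan ℝ (colSet S) : Set (ι → ℝ)) ∩ {x | ∀ i, 0 ≤ x i}

/-- The matrix obtained from `S` by appending the entrywise complement `1 - S_i` of row `i`. -/
def appendComplementRow {m n : ℕ} (S : Matrix (Fin m) (Fin n) ℝ) (i : Fin m) :
    Matrix (Fin m ⊕ Unit) (Fin n) ℝ :=
  fun r j =>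
    match r with
    | Sum.inl r' => S r' j
    | Sum.inr _ => 1 - S i j

/-- The affine map appending to `x` the coordinate `1 - x i`. -/
def appendComplementMap {ι : Type*} (i : ι) : (ι → ℝ) →ᵃ[ℝ] (ι ⊕ Unit → ℝ) :=
  AffineMap.pi (Sum.elim (fun r => AffineMap.proj r)
    (fun _ => AffineMap.const ℝ (ι → ℝ) (1 : ℝ) - AffineMap.proj i))

@[simp]
theorem appendComplementMap_inl {ι : Type*} (i r : ι) (x : ι → ℝ) :
    appendComplementMap i x (Sum.inl r) = x r := rfl

@[simp]
theorem appendComplementMap_inr {ι : Type*} (i : ι) (u : Unit) (x : ι → ℝ) :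
    appendComplementMap i x (Sum.inr u) = 1 - x i := rfl

theorem colSet_appendComplementRow {m n : ℕ} (S : Matrix (Fin m) (Fin n) ℝ) (i : Fin m) :
    colSet (appendComplementRow S i) = appendComplementMap i '' colSet S := by
  rw [colSet, colSet, ← Set.range_comp]
  congr 1
  funext j r
  cases r <;> rfl

theorem convexHull_colSet_nonneg {ι κ : Type*} {S : Matrix ι κ ℝ} (hS : ∀ i j, 0 ≤ S i j) :
    convexHull ℝ (colSet S) ⊆ {x | ∀ i, 0 ≤ x i} :=
  convexHull_min (Set.range_subset_iff.2 fun j i => hS i j) (convex_Ici 0)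

theorem appendComplementRow_nonneg {m n : ℕ} {S : Matrix (Fin m) (Fin n) ℝ} {i : Fin m}
    (hS : ∀ r j, 0 ≤ S r j) (hi : ∀ j, S i j ≤ 1) :
    ∀ r j, 0 ≤ appendComplementRow S i r j
  | Sum.inl r, j => hS r j
  | Sum.inr _, j => sub_nonneg.2 (hi j)

/-- If `S ∈ ℝ₊^{m×n}` is a slack matrix and row `i` of `S` is 0/1-valued,
then the matrix `S'` obtained by appending the complementary row `1 - S_i` is again a slack
matrix. -/
theorem appendComplementRow_isSlackMatrix {m n : ℕ}
    (S : Matrix (Fin m) (Fin n) ℝ) (i : Fin m)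
    (hS : IsSlackMatrix S)
    (h01 : ∀ j, S i j = 0 ∨ S i j = 1) :
    IsSlackMatrix (appendComplementRow S i) := by
  have hnonneg := appendComplementRow_nonneg (i := i) hS.1 fun j => by
    rcases h01 j with h | h <;> simp [h]
  refine ⟨hnonneg, (Set.subset_inter (convexHull_subset_affineSpan _)
    (convexHull_colSet_nonneg hnonneg)).antisymm ?_⟩
  rw [colSet_appendComplementRow, ← AffineSubspace.map_span, ← AffineMap.image_convexHull, hS.2]
  rintro _ ⟨⟨x, hx, rfl⟩, hpos⟩
  exact ⟨x, ⟨hx, fun r => hpos (Sum.inl r)⟩, rfl⟩
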